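/- For positive integers m, n define G(m,n) = Σ_ν Σ_{(i,j)∈ν} i, where ν ranges over all partitions fitting in the m×n box and (i,j) ranges over the cells of ν. Then for all m, n ≥ 2, G(m,n) = G(m−1, n) + G(m, n−1) + C(m+1, 2) · C(m+n−1, m). -/

import Mathlib

/-- A partition, given by its (0-indexed) weakly decreasing sequence of parts,
which is eventually zero. Row `i` of the Young diagram has `parts i` cells;
the diagram consists of the (0-indexed) cells `(i, j)` with `j < parts i`. -/
structure YPartition where
  parts : ℕ → ℕ
  antitone : ∀ ⦃i j : ℕ⦄, i ≤ j → parts j ≤ parts i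
  finite_support : ∃ N, ∀ i, N ≤ i → parts i = 0

namespace YPartition

/-- The `j`-th (0-indexed) part of the conjugate partition: the number of rows
whose length exceeds `j`. -/
noncomputable def conj (p : YPartition) (j : ℕ) : ℕ := Set.ncard {i : ℕ | j < p.parts i}

/-- The set of (0-indexed) cells of the Young diagram. -/
def cells (p : YPartition) : Set (ℕ × ℕ) := {c | c.2 < p.parts c.1}

/-- The size of a partition: the number of cells of its Young diagram. -/
noncomputable def size (p : YPartition) : ℕ := p.cells.ncard

/-- The hook length of the (0-indexed) cell `(i, j)`:
`λ_i − j + λ'_j − i + 1` in 1-indexed terms. -/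
noncomputable def hook (p : YPartition) (i j : ℕ) : ℕ := p.parts i + p.conj j - i - j - 1

/-- A partition is self-conjugate if it equals its conjugate. -/
def SelfConj (p : YPartition) : Prop := ∀ j, p.conj j = p.parts j

/-- A partition is a `t`-core if no cell of its diagram has hook length `t`. -/
def IsCore (t : ℕ) (p : YPartition) : Prop :=
  ∀ i j : ℕ, (i, j) ∈ p.cells → p.hook i j ≠ t

/-- The set of hook lengths of the main diagonal cells. -/
def MD (p : YPartition) : Set ℕ := {h | ∃ i : ℕ, i < p.parts i ∧ h = p.hook i i}

end YPartition

/-- Partitions fitting in the `m × n` box: at most `m` parts, each of size at most `n`. -/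
def boxSet (m n : ℕ) : Set YPartition := {ν | ν.parts 0 ≤ n ∧ ν.parts m = 0}

/-- `G(m,n) = Σ_ν Σ_{(i,j)∈ν} i`, summed over partitions `ν` fitting in the
`m × n` box and over (1-indexed) cells `(i,j)` of `ν`. -/
noncomputable def G (m n : ℕ) : ℕ :=
  ∑ᶠ ν ∈ boxSet m n, ∑ i ∈ Finset.Icc 1 m, ∑ _j ∈ Finset.Icc 1 (ν.parts (i - 1)), i

theorem YPartition.ext_parts {p q : YPartition} (h : ∀ i, p.parts i = q.parts i) : p = q := by
  cases p; cases q
  simp only [YPartition.mk.injEq]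
  exact funext h

/-- Add one cell to each of the first `m` rows. -/
def addCol (m : ℕ) (p : YPartition) : YPartition where
  parts i := p.parts i + if i < m then 1 else 0
  antitone := by
    intro i j h
    have := p.antitone h
    split_ifs <;> omega
  finite_support := by
    obtain ⟨N, hN⟩ := p.finite_support
    refine ⟨N + m, fun i hi => ?_⟩
    rw [hN i (by omega), if_neg (by omega)]

theorem addCol_injective (m : ℕ) : Function.Injective (addCol m) := by
  intro p q h
  apply YPartition.ext_parts
  intro i
  have h2 : (addCol m p).parts i = (addCol m q).parts i := by rw [h]
  simpa [addCol] using h2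

theorem box_decomp (m n : ℕ) :
    boxSet (m + 1) (n + 1) = boxSet m (n + 1) ∪ addCol (m + 1) '' boxSet (m + 1) n := by
  ext p
  simp only [boxSet, Set.mem_union, Set.mem_ofPred_eq, Set.mem_image]
  constructor
  · rintro ⟨h0, h1⟩
    by_cases hp : p.parts m = 0
    · exact Or.inl ⟨h0, hp⟩
    · right
      have hpos : ∀ i, i < m + 1 → 1 ≤ p.parts i := fun i hi => by
        have := p.antitone (show i ≤ m by omega)
        omega
      have hz : ∀ i, m + 1 ≤ i → p.parts i = 0 := fun i hi => by
        have := p.antitone hi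
        omega
      refine ⟨⟨fun i => p.parts i - 1, ?_, ?_⟩, ⟨?_, ?_⟩, ?_⟩
      · intro i j h
        have := p.antitone h
        skip
        omega
      · exact ⟨m + 1, fun i hi => by have := hz i hi; omega⟩
      · dsimp only; omega
      · dsimp only; omega
      · apply YPartition.ext_parts
        intro i
        simp only [addCol]
        split_ifs with hi
        · have := hpos i hi; omega
        · have := hz i (by omega); omega
  · rintro (⟨h0, h1⟩ | ⟨q, ⟨h0, h1⟩, rfl⟩)
    · have := p.antitone (show m ≤ m + 1 by omega)
      exact ⟨h0, by omega⟩
    · simp [addCol, h0, h1]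

theorem box_disj (m n : ℕ) :
    Disjoint (boxSet m (n + 1)) (addCol (m + 1) '' boxSet (m + 1) n) := by
  rw [Set.disjoint_left]
  rintro p ⟨_, h1⟩ ⟨q, _, rfl⟩
  simp [addCol] at h1

theorem box_zero (m n : ℕ) (h : m = 0 ∨ n = 0) :
    boxSet m n = {⟨fun _ => 0, fun _ _ _ => le_rfl, 0, fun _ _ => rfl⟩} := by
  ext p
  simp only [boxSet, Set.mem_ofPred_eq, Set.mem_singleton_iff]
  constructor
  · rintro ⟨h0, h1⟩
    apply YPartition.ext_parts
    intro i
    have := p.antitone (Nat.zero_le i)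
    rcases h with rfl | rfl
    · dsimp only; omega
    · dsimp only; omega
  · rintro rfl
    simp

theorem box_finite_card (m n : ℕ) :
    (boxSet m n).Finite ∧ (boxSet m n).ncard = Nat.choose (m + n) m := by
  induction m generalizing n with
  | zero => rw [box_zero 0 n (Or.inl rfl)]; simp
  | succ m ihm =>
    induction n with
    | zero => rw [box_zero (m + 1) 0 (Or.inr rfl)]; simp
    | succ n ihn =>
      obtain ⟨f1, c1⟩ := ihm (n + 1)
      obtain ⟨f2, c2⟩ := ihn
      have f3 := f2.image (addCol (m + 1))
      rw [box_decomp]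
      refine ⟨f1.union f3, ?_⟩
      rw [Set.ncard_union_eq (box_disj m n) f1 f3,
        Set.ncard_image_of_injective _ (addCol_injective _), c1, c2]
      rw [show m + 1 + (n + 1) = (m + n + 1) + 1 by ring, Nat.choose_succ_succ]
      congr 2
      ring

theorem sum_Icc_id (m : ℕ) : ∑ i ∈ Finset.Icc 1 m, i = Nat.choose (m + 1) 2 := by
  induction m with
  | zero => simp
  | succ m ih =>
    rw [Finset.sum_Icc_succ_top (by omega), ih, Nat.choose_succ_succ (m + 1) 1]
    simp
    ring

/-- The recurrence in successor form. -/
theorem G_succ (m n : ℕ) :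
    G (m + 1) (n + 1) = G m (n + 1) + G (m + 1) n
      + Nat.choose (m + 2) 2 * Nat.choose (m + 1 + n) (m + 1) := by
  obtain ⟨f1, c1⟩ := box_finite_card m (n + 1)
  obtain ⟨f2, c2⟩ := box_finite_card (m + 1) n
  have f3 := f2.image (addCol (m + 1))
  unfold G
  rw [box_decomp, finsum_mem_union (box_disj m n) f1 f3,
    finsum_mem_image (addCol_injective _).injOn, add_assoc]
  congr 1
  · apply finsum_mem_congr rfl
    rintro p ⟨_, hp⟩
    rw [Finset.sum_Icc_succ_top (by omega)]
    simp [hp]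
  · have key : ∀ p ∈ boxSet (m + 1) n,
        ∑ i ∈ Finset.Icc 1 (m + 1),
          ∑ _j ∈ Finset.Icc 1 ((addCol (m + 1) p).parts (i - 1)), i
        = (∑ i ∈ Finset.Icc 1 (m + 1), ∑ _j ∈ Finset.Icc 1 (p.parts (i - 1)), i)
          + Nat.choose (m + 2) 2 := by
      intro p _
      rw [← sum_Icc_id (m + 1), ← Finset.sum_add_distrib]
      apply Finset.sum_congr rfl
      intro i hi
      rw [Finset.mem_Icc] at hi
      have : i - 1 < m + 1 := by omega
      simp only [addCol, if_pos this, Finset.sum_const, Nat.card_Icc, smul_eq_mul]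
      simp
      ring
    rw [finsum_mem_congr rfl key, finsum_mem_add_distrib f2]
    congr 1
    rw [← c2, finsum_mem_eq_finite_toFinset_sum _ f2, Finset.sum_const,
      ← Set.ncard_eq_toFinset_card _ f2, smul_eq_mul, mul_comm]

/-- The recurrence `G(m,n) = G(m−1,n) + G(m,n−1) + C(m+1,2) · C(m+n−1, m)`
for `m, n ≥ 2`. -/
theorem G_recurrence (m n : ℕ) (hm : 2 ≤ m) (hn : 2 ≤ n) :
    G m n = G (m - 1) n + G m (n - 1)
      + Nat.choose (m + 1) 2 * Nat.choose (m + n - 1) m := by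
  obtain ⟨a, rfl⟩ : ∃ a, m = a + 1 := ⟨m - 1, by omega⟩
  obtain ⟨b, rfl⟩ : ∃ b, n = b + 1 := ⟨n - 1, by omega⟩
  exact G_succ a b
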